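/- arXiv:2501.03725 — 2 statements merged into one kernel-verified Lean document; each statement's English description precedes it below -/
import Mathlib

section
/- Assume α_r > 1, β_r > 0, α_R > 0, β_R > 0, and additionally (α_r − 1)(α_R + 2) > 1 in case α_r ∈ (1, 2]. Then for any constants A > 0 and B ≥ 0, the function AC_X(h) = (A·I₁(h) + B·(I₂(h)+I₃(h))) / (A·I₁(0) + B·(I₂(0)+I₃(0))) satisfies lim_{h→+∞} AC_X(h) = 0. -/
open MeasureTheory Set Real Filter

/-- Gamma probability density with shape `α` and scale `β`. -/
noncomputable def gammaDensity (a b x : ℝ) : ℝ :=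
  x ^ (a - 1) * Real.exp (-x / b) / (Real.Gamma a * b ^ a)

/-- `I₁(h)` from Proposition 2. -/
noncomputable def I1 (aR bR h : ℝ) : ℝ :=
  ∫ R in Ioi (0:ℝ), Real.exp (-R * h) * gammaDensity aR bR R

/-- `I₂(h)` from Proposition 2. -/
noncomputable def I2 (ar br aR bR h : ℝ) : ℝ :=
  ∫ P in Ioi (0:ℝ), ∫ R in Ioi (0:ℝ), ∫ r in Ioi (0:ℝ),
    (R * P / (r * (P + R))) * (1 / (P + r) + 1 / (R + r)) * Real.exp (-P * h) *
      gammaDensity ar br r * gammaDensity aR bR R * gammaDensity aR bR P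

/-- `I₃(h)` from Proposition 2, with the integrand extended continuously to `{P = r}`. -/
noncomputable def I3 (ar br aR bR h : ℝ) : ℝ :=
  ∫ P in Ioi (0:ℝ), ∫ R in Ioi (0:ℝ), ∫ r in Ioi (0:ℝ),
    (if P = r then h * Real.exp (-r * h) * (R * P / (r * (R + r)))
      else (R * P / (r * (R + r) * (P - r))) *
        (Real.exp (-r * h) - Real.exp (-P * h))) *
      gammaDensity ar br r * gammaDensity aR bR R * gammaDensity aR bR P

/-- The autocorrelation `AC_X(h)` expressed via `I₁, I₂, I₃`. -/
noncomputable def ACX (ar br aR bR A B h : ℝ) : ℝ :=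
  (A * I1 aR bR h + B * (I2 ar br aR bR h + I3 ar br aR bR h)) /
    (A * I1 aR bR 0 + B * (I2 ar br aR bR 0 + I3 ar br aR bR 0))

lemma gd_nonneg {a b x : ℝ} (ha : 0 < a) (hb : 0 < b) (hx : 0 < x) : 0 ≤ gammaDensity a b x := by
  unfold gammaDensity
  have := Real.Gamma_pos_of_pos ha
  positivity

lemma gd_meas (a b : ℝ) : Measurable (gammaDensity a b) := by
  unfold gammaDensity
  fun_prop

lemma aux_int {s b : ℝ} (hs : -1 < s) (hb : 0 < b) :
    IntegrableOn (fun x : ℝ => x ^ s * Real.exp (-x / b)) (Ioi 0) := by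
  have h := integrableOn_rpow_mul_exp_neg_mul_rpow (p := 1) (s := s) (b := b⁻¹) hs one_pos
    (by positivity)
  refine h.congr_fun (fun x _ => ?_) measurableSet_Ioi
  simp only [Real.rpow_one]
  congr 2
  field_simp

lemma gd_int {a b : ℝ} (ha : 0 < a) (hb : 0 < b) : IntegrableOn (gammaDensity a b) (Ioi 0) := by
  unfold gammaDensity
  exact (aux_int (by linarith) hb).div_const _

lemma gd_int' {a b : ℝ} (ha : 1 < a) (hb : 0 < b) :
    IntegrableOn (fun x => 2 * (x⁻¹ * gammaDensity a b x)) (Ioi 0) := by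
  have h := ((aux_int (s := a - 2) (by linarith) hb).div_const (Real.Gamma a * b ^ a)).const_mul 2
  refine IntegrableOn.congr_fun h (fun x hx => ?_) measurableSet_Ioi
  have hx : 0 < x := hx
  have e : x ^ (a - 2) = x⁻¹ * x ^ (a - 1) := by
    rw [← Real.rpow_neg_one, ← Real.rpow_add hx]; ring_nf
  simp only [gammaDensity, e]
  ring

lemma dct (G : ℝ → ℝ → ℝ) (c : ℝ → ℝ) (hc : IntegrableOn c (Ioi 0))
    (hm : ∀ h, Measurable (G h))
    (hb : ∀ h, 0 ≤ h → ∀ x, 0 < x → |G h x| ≤ c x)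
    (hl : ∀ x, 0 < x → Tendsto (fun h => G h x) atTop (nhds 0)) :
    Tendsto (fun h => ∫ x in Ioi (0:ℝ), G h x) atTop (nhds 0) := by
  have := tendsto_integral_filter_of_dominated_convergence (μ := volume.restrict (Ioi (0:ℝ)))
    (l := atTop) (F := G) (f := fun _ => (0:ℝ)) c
    (Eventually.of_forall fun h => (hm h).aestronglyMeasurable)
    (by
      filter_upwards [eventually_ge_atTop (0:ℝ)] with h hh
      filter_upwards [ae_restrict_mem measurableSet_Ioi] with x hx
      exact hb h hh x hx) hc
    (by
      filter_upwards [ae_restrict_mem measurableSet_Ioi] with x hx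
      exact hl x hx)
  simpa using this

lemma bnd (g c : ℝ → ℝ) (hc : IntegrableOn c (Ioi 0)) (hb : ∀ x, 0 < x → |g x| ≤ c x) :
    |∫ x in Ioi (0:ℝ), g x| ≤ ∫ x in Ioi (0:ℝ), c x := by
  rw [← Real.norm_eq_abs]
  refine norm_integral_le_of_norm_le hc ?_
  filter_upwards [ae_restrict_mem measurableSet_Ioi] with x hx
  exact hb x hx

lemma dct3 (F : ℝ → ℝ → ℝ → ℝ → ℝ) (a b c : ℝ → ℝ)
    (ha : IntegrableOn a (Ioi 0)) (hb : IntegrableOn b (Ioi 0)) (hc : IntegrableOn c (Ioi 0))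
    (hm : ∀ h, Measurable (fun p : (ℝ × ℝ) × ℝ => F h p.1.1 p.1.2 p.2))
    (hF : ∀ h, 0 ≤ h → ∀ P, 0 < P → ∀ R, 0 < R → ∀ r, 0 < r → |F h P R r| ≤ c r * b R * a P)
    (hl : ∀ P, 0 < P → ∀ R, 0 < R → ∀ r, 0 < r → Tendsto (fun h => F h P R r) atTop (nhds 0)) :
    Tendsto (fun h => ∫ P in Ioi (0:ℝ), ∫ R in Ioi (0:ℝ), ∫ r in Ioi (0:ℝ), F h P R r)
      atTop (nhds 0) := by
  have m1 : ∀ h P R, Measurable (F h P R) := fun h P R =>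
    (hm h).comp (g := fun p : (ℝ × ℝ) × ℝ => F h p.1.1 p.1.2 p.2)
      (f := fun r => ((P, R), r)) (by fun_prop)
  have m2 : ∀ h, StronglyMeasurable (fun p : ℝ × ℝ => ∫ r in Ioi (0:ℝ), F h p.1 p.2 r) := fun h =>
    (hm h).stronglyMeasurable.integral_prod_right'
  have m3 : ∀ h, StronglyMeasurable
      (fun P : ℝ => ∫ R in Ioi (0:ℝ), ∫ r in Ioi (0:ℝ), F h P R r) := fun h =>
    (m2 h).integral_prod_right'
  have b1 : ∀ h, 0 ≤ h → ∀ P, 0 < P → ∀ R, 0 < R →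
      |∫ r in Ioi (0:ℝ), F h P R r| ≤ (∫ r in Ioi (0:ℝ), c r) * b R * a P := by
    intro h hh P hP R hR
    have := bnd (F h P R) (fun r => c r * b R * a P) ((hc.mul_const _).mul_const _)
      (hF h hh P hP R hR)
    rwa [integral_mul_const, integral_mul_const] at this
  have b2 : ∀ h, 0 ≤ h → ∀ P, 0 < P →
      |∫ R in Ioi (0:ℝ), ∫ r in Ioi (0:ℝ), F h P R r| ≤
        (∫ r in Ioi (0:ℝ), c r) * (∫ r in Ioi (0:ℝ), b r) * a P := by
    intro h hh P hP
    have := bnd _ (fun R => (∫ r in Ioi (0:ℝ), c r) * b R * a P) ((hb.const_mul _).mul_const _)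
      (b1 h hh P hP)
    rwa [integral_mul_const, integral_const_mul] at this
  refine dct _ _ (ha.const_mul ((∫ r in Ioi (0:ℝ), c r) * (∫ r in Ioi (0:ℝ), b r)))
    (fun h => (m3 h).measurable) b2 fun P hP => ?_
  refine dct _ _ ((hb.const_mul (∫ r in Ioi (0:ℝ), c r)).mul_const (a P))
    (fun h => ((m2 h).measurable.comp (g := fun p : ℝ × ℝ => ∫ r in Ioi (0:ℝ), F h p.1 p.2 r)
      (f := fun R => (P, R)) (by fun_prop))) (fun h hh R hR => b1 h hh P hP R hR) fun R hR => ?_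
  exact dct _ _ ((hc.mul_const (b R)).mul_const (a P)) (fun h => m1 h P R)
    (fun h hh r hr => hF h hh P hP R hR r hr) fun r hr => hl P hP R hR r hr

lemma exp_tend {P : ℝ} (hP : 0 < P) : Tendsto (fun h => Real.exp (-P * h)) atTop (nhds 0) :=
  Real.tendsto_exp_atBot.comp (tendsto_id.const_mul_atTop_of_neg (by linarith))

lemma key {a d : ℝ} (ha : 0 ≤ a) (hd : 0 ≤ d) :
    (a + d) * (Real.exp (-a) - Real.exp (-(a + d))) ≤ d := by
  have h1 : d * Real.exp (-a) * (a + 1) ≤ d := by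
    have := mul_le_mul_of_nonneg_left (Real.add_one_le_exp a) (Real.exp_pos (-a)).le
    rw [← Real.exp_add] at this
    simp at this
    nlinarith
  have h2 : Real.exp (-(a + d)) = Real.exp (-a) * Real.exp (-d) := by
    rw [← Real.exp_add]; ring_nf
  have h3 := Real.add_one_le_exp (-d)
  have h4 := Real.exp_pos (-a)
  have h5 := Real.exp_pos (-d)
  rw [h2]
  have h6 : (a + d) * (1 - Real.exp (-d)) ≤ d * (a + 1) := by nlinarith
  have := mul_le_mul_of_nonneg_left h6 h4.le
  nlinarith

/-- the divided difference bound -/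
lemma dd {h P r : ℝ} (hh : 0 ≤ h) (hP : 0 < P) (hr : 0 < r) (hne : P ≠ r) :
    |(Real.exp (-r * h) - Real.exp (-P * h)) / (P - r)| ≤ 1 / P := by
  rcases hh.eq_or_lt with rfl | hh
  · simp; positivity
  have hd : 0 < |P - r| := abs_pos.2 (sub_ne_zero.2 hne)
  rw [abs_div, div_le_div_iff₀ hd hP, one_mul]
  rcases lt_or_gt_of_ne hne with hlt | hlt
  · have k := key (a := P * h) (d := (r - P) * h) (by positivity)
      (mul_nonneg (by linarith) hh.le)
    have e : P * h + (r - P) * h = r * h := by ring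
    rw [e] at k
    have hle : Real.exp (-r * h) ≤ Real.exp (-P * h) := Real.exp_le_exp.2 (by nlinarith)
    rw [abs_of_nonpos (by linarith), abs_of_neg (by linarith)]
    rw [← neg_mul, ← neg_mul] at k
    have k2 : r * (Real.exp (-P * h) - Real.exp (-r * h)) ≤ r - P := by
      refine le_of_mul_le_mul_right ?_ hh
      linarith
    nlinarith
  · have k := key (a := r * h) (d := (P - r) * h) (by positivity)
      (mul_nonneg (by linarith) hh.le)
    have e : r * h + (P - r) * h = P * h := by ring
    rw [e] at k
    have hle : Real.exp (-P * h) ≤ Real.exp (-r * h) := Real.exp_le_exp.2 (by nlinarith)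
    rw [abs_of_nonneg (by linarith), abs_of_pos (by linarith)]
    rw [← neg_mul, ← neg_mul] at k
    refine le_of_mul_le_mul_right ?_ hh
    linarith

lemma he_bound {h r : ℝ} (hr : 0 < r) : h * Real.exp (-r * h) ≤ 1 / r := by
  rw [le_div_iff₀ hr]
  have := mul_le_mul_of_nonneg_left (Real.add_one_le_exp (r * h)) (Real.exp_pos (-r * h)).le
  rw [← Real.exp_add] at this
  have e : -r * h + r * h = 0 := by ring
  rw [e, Real.exp_zero] at this
  have := Real.exp_pos (-r * h)
  nlinarith

lemma he_tend {r : ℝ} (hr : 0 < r) : Tendsto (fun h => h * Real.exp (-r * h)) atTop (nhds 0) := by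
  have := Real.tendsto_pow_mul_exp_neg_atTop_nhds_zero 1
  have h2 := (this.comp (tendsto_id.const_mul_atTop hr)).const_mul r⁻¹
  simp only [mul_zero] at h2
  refine h2.congr fun h => ?_
  simp only [Function.comp, id, pow_one, neg_mul]
  field_simp

lemma wrap {k r g1 g2 g3 : ℝ} (h1 : 0 ≤ g1) (h2 : 0 ≤ g2) (h3 : 0 ≤ g3) (hk : |k| ≤ 2 * r⁻¹) :
    |k * g1 * g2 * g3| ≤ 2 * (r⁻¹ * g1) * g2 * g3 := by
  rw [abs_mul, abs_mul, abs_mul, abs_of_nonneg h1, abs_of_nonneg h2, abs_of_nonneg h3, ← mul_assoc]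
  gcongr

lemma tend1 {aR bR : ℝ} (haR : 0 < aR) (hbR : 0 < bR) :
    Tendsto (fun h => I1 aR bR h) atTop (nhds 0) := by
  unfold I1
  have gm := gd_meas aR bR
  refine dct _ _ (gd_int haR hbR) (fun h => by fun_prop) (fun h hh x hx => ?_) fun x hx => ?_
  · have hg := gd_nonneg haR hbR hx
    rw [abs_mul, abs_of_nonneg hg, abs_of_pos (Real.exp_pos _)]
    exact mul_le_of_le_one_left hg (Real.exp_le_one_iff.2 (by nlinarith))
  · simpa using (exp_tend hx).mul_const (gammaDensity aR bR x)

lemma tend2 {ar br aR bR : ℝ} (har : 1 < ar) (hbr : 0 < br) (haR : 0 < aR) (hbR : 0 < bR) :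
    Tendsto (fun h => I2 ar br aR bR h) atTop (nhds 0) := by
  unfold I2
  have gm := gd_meas aR bR
  have gm' := gd_meas ar br
  refine dct3 _ (gammaDensity aR bR) (gammaDensity aR bR) _ (gd_int haR hbR) (gd_int haR hbR)
    (gd_int' har hbr) (fun h => by fun_prop) ?_ ?_
  · intro h hh P hP R hR r hr
    refine wrap (gd_nonneg (by linarith) hbr hr) (gd_nonneg haR hbR hR) (gd_nonneg haR hbR hP) ?_
    rw [abs_of_nonneg (by positivity)]
    have h1 : Real.exp (-P * h) ≤ 1 := Real.exp_le_one_iff.2 (by nlinarith)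
    refine (mul_le_of_le_one_right (by positivity) h1).trans ?_
    have e : R * P / (r * (P + R)) * (1 / (P + r) + 1 / (R + r)) =
      (R / (P + R) * (P / (P + r)) + P / (P + R) * (R / (R + r))) * r⁻¹ := by
      field_simp
    rw [e]
    have a1 : R / (P + R) ≤ 1 := (div_le_one (by positivity)).2 (by linarith)
    have a2 : P / (P + r) ≤ 1 := (div_le_one (by positivity)).2 (by linarith)
    have a3 : P / (P + R) ≤ 1 := (div_le_one (by positivity)).2 (by linarith)
    have a4 : R / (R + r) ≤ 1 := (div_le_one (by positivity)).2 (by linarith)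
    have b1 := mul_le_one₀ a1 (by positivity) a2
    have b2 := mul_le_one₀ a3 (by positivity) a4
    gcongr
    linarith
  · intro P hP R hR r hr
    simpa using ((((exp_tend hP).const_mul (R * P / (r * (P + R)) * (1 / (P + r) + 1 / (R + r)))).mul_const
      (gammaDensity ar br r)).mul_const (gammaDensity aR bR R)).mul_const (gammaDensity aR bR P)

lemma tend3 {ar br aR bR : ℝ} (har : 1 < ar) (hbr : 0 < br) (haR : 0 < aR) (hbR : 0 < bR) :
    Tendsto (fun h => I3 ar br aR bR h) atTop (nhds 0) := by
  unfold I3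
  have gm := gd_meas aR bR
  have gm' := gd_meas ar br
  refine dct3 _ (gammaDensity aR bR) (gammaDensity aR bR) _ (gd_int haR hbR) (gd_int haR hbR)
    (gd_int' har hbr) (fun h => ?_) ?_ ?_
  · have : Measurable (fun p : (ℝ × ℝ) × ℝ =>
      if p.1.1 = p.2 then h * Real.exp (-p.2 * h) * (p.1.2 * p.1.1 / (p.2 * (p.1.2 + p.2)))
      else (p.1.2 * p.1.1 / (p.2 * (p.1.2 + p.2) * (p.1.1 - p.2))) *
        (Real.exp (-p.2 * h) - Real.exp (-p.1.1 * h))) := by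
      refine Measurable.ite (measurableSet_eq_fun (by fun_prop) (by fun_prop)) ?_ ?_ <;> fun_prop
    fun_prop
  · intro h hh P hP R hR r hr
    refine wrap (gd_nonneg (by linarith) hbr hr) (gd_nonneg haR hbR hR) (gd_nonneg haR hbR hP) ?_
    have a4 : R / (R + r) ≤ 1 := (div_le_one (by positivity)).2 (by linarith)
    have hri : 0 < r⁻¹ := by positivity
    split_ifs with hPr
    · subst hPr
      rw [abs_of_nonneg (by positivity)]
      calc _ ≤ 1 / P * (R * P / (P * (R + P))) := by
              gcongr
              exact he_bound hP
        _ = R / (R + P) * P⁻¹ := by field_simp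
        _ ≤ 1 * P⁻¹ := by gcongr
        _ ≤ _ := by linarith
    · have hd : P - r ≠ 0 := sub_ne_zero.2 hPr
      have e : R * P / (r * (R + r) * (P - r)) * (Real.exp (-r * h) - Real.exp (-P * h)) =
        (R * P / (r * (R + r))) * ((Real.exp (-r * h) - Real.exp (-P * h)) / (P - r)) := by
        field_simp
      rw [e, abs_mul, abs_of_nonneg (by positivity)]
      calc _ ≤ (R * P / (r * (R + r))) * (1 / P) := by
              gcongr
              exact dd hh hP hr hPr
        _ = R / (R + r) * r⁻¹ := by field_simp
        _ ≤ 1 * r⁻¹ := by gcongr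
        _ ≤ _ := by linarith
  · intro P hP R hR r hr
    split_ifs with hPr
    · simpa using ((((he_tend hr).mul_const (R * P / (r * (R + r)))).mul_const
        (gammaDensity ar br r)).mul_const (gammaDensity aR bR R)).mul_const (gammaDensity aR bR P)
    · simpa using (((((exp_tend hr).sub (exp_tend hP)).const_mul
        (R * P / (r * (R + r) * (P - r)))).mul_const
        (gammaDensity ar br r)).mul_const (gammaDensity aR bR R)).mul_const (gammaDensity aR bR P)

theorem stmt6 (ar br aR bR A B : ℝ) (har : 1 < ar) (hbr : 0 < br)
    (haR : 0 < aR) (hbR : 0 < bR)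
    (hcond : ar ≤ 2 → (ar - 1) * (aR + 2) > 1)
    (hA : 0 < A) (hB : 0 ≤ B) :
    Tendsto (fun h => ACX ar br aR bR A B h) atTop (nhds 0) := by
  unfold ACX
  simpa using (((tend1 haR hbR).const_mul A).add
    (((tend2 har hbr haR hbR).add (tend3 har hbr haR hbR)).const_mul B)).div_const
    (A * I1 aR bR 0 + B * (I2 ar br aR bR 0 + I3 ar br aR bR 0))
end

section
/- Assume α_r ∈ (1, 2], β_r > 0, α_R > 0, β_R > 0, and (α_r − 1)(α_R + 2) > 1, and set η = ((α_r − 1)(α_R + 2) − 1)/(α_R + 2) > 0. Then for any constants A > 0 and B ≥ 0 there exist C > 0 and h₀ > 0 such that for all h ≥ h₀, the function AC_X(h) = (A·I₁(h) + B·(I₂(h)+I₃(h))) / (A·I₁(0) + B·(I₂(0)+I₃(0))) satisfies AC_X(h) ≤ C·(A·h^{-α_R} + B·(h^{-α_R} + h^{-η})). -/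
open MeasureTheory Set Real Filter

lemma aux_base (s c : ℝ) (hs : 0 < s) (hc : 0 < c) :
    IntegrableOn (fun x : ℝ => x ^ (s - 1) * Real.exp (-(c * x))) (Ioi 0) ∧
    ∫ x in Ioi (0:ℝ), x ^ (s - 1) * Real.exp (-(c * x)) = (1 / c) ^ s * Real.Gamma s := by
  refine ⟨?_, Real.integral_rpow_mul_exp_neg_mul_Ioi hs hc⟩
  have h := integrableOn_rpow_mul_exp_neg_mul_rpow (p := 1) (s := s - 1) (b := c)
    (by linarith) one_pos hc
  simpa using h

lemma gd_pos (a b x : ℝ) (ha : 0 < a) (hb : 0 < b) (hx : 0 < x) : 0 < gammaDensity a b x := by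
  unfold gammaDensity
  have := Real.Gamma_pos_of_pos ha
  positivity

lemma gd_exp (a b t : ℝ) (ha : 0 < a) (hb : 0 < b) (ht : 0 ≤ t) :
    IntegrableOn (fun x => Real.exp (-x * t) * gammaDensity a b x) (Ioi 0) ∧
    ∫ x in Ioi (0:ℝ), Real.exp (-x * t) * gammaDensity a b x
      = (1 / (t + 1 / b)) ^ a * (Real.Gamma a * (Real.Gamma a * b ^ a)⁻¹) := by
  obtain ⟨h1, h2⟩ := aux_base a (t + 1 / b) ha (by positivity)
  have e : (fun x => Real.exp (-x * t) * gammaDensity a b x) =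
      fun x => (x ^ (a - 1) * Real.exp (-((t + 1 / b) * x))) * (Real.Gamma a * b ^ a)⁻¹ := by
    funext x
    unfold gammaDensity
    rw [show -((t + 1 / b) * x) = -x * t + -x / b by ring, Real.exp_add]
    ring
  rw [e]
  refine ⟨h1.mul_const _, ?_⟩
  rw [integral_mul_const, h2]; ring

lemma gd_exp_inv (a b t : ℝ) (ha : 1 < a) (hb : 0 < b) (ht : 0 ≤ t) :
    IntegrableOn (fun x => Real.exp (-x * t) / x * gammaDensity a b x) (Ioi 0) ∧
    ∫ x in Ioi (0:ℝ), Real.exp (-x * t) / x * gammaDensity a b x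
      = (1 / (t + 1 / b)) ^ (a - 1) * (Real.Gamma (a - 1) * (Real.Gamma a * b ^ a)⁻¹) := by
  obtain ⟨h1, h2⟩ := aux_base (a - 1) (t + 1 / b) (by linarith) (by positivity)
  have e : EqOn (fun x => (x ^ (a - 1 - 1) * Real.exp (-((t + 1 / b) * x))) *
      (Real.Gamma a * b ^ a)⁻¹) (fun x => Real.exp (-x * t) / x * gammaDensity a b x)
      (Ioi 0) := by
    intro x hx
    have hx : 0 < x := hx
    simp only
    unfold gammaDensity
    rw [show -((t + 1 / b) * x) = -x * t + -x / b by ring, Real.exp_add,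
      Real.rpow_sub_one hx.ne' (a - 1)]
    ring
  refine ⟨IntegrableOn.congr_fun (h1.mul_const _) e measurableSet_Ioi, ?_⟩
  rw [← setIntegral_congr_fun measurableSet_Ioi e, integral_mul_const, h2]; ring

lemma pow_bd (s t b : ℝ) (hs : 0 < s) (ht : 0 < t) (hb : 0 < b) :
    (1 / (t + 1 / b)) ^ s ≤ t ^ (-s) := by
  rw [Real.rpow_neg ht.le, ← Real.inv_rpow ht.le, one_div]
  apply Real.rpow_le_rpow (by positivity) _ hs.le
  apply inv_anti₀ ht
  have : 0 < 1 / b := by positivity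
  linarith

lemma gd_exp_le (a b : ℝ) (ha : 0 < a) (hb : 0 < b) : ∃ c > (0:ℝ), ∀ t > 0,
    ∫ x in Ioi (0:ℝ), Real.exp (-x * t) * gammaDensity a b x ≤ c * t ^ (-a) := by
  have hg := Real.Gamma_pos_of_pos ha
  refine ⟨Real.Gamma a * (Real.Gamma a * b ^ a)⁻¹, by positivity, fun t ht => ?_⟩
  rw [(gd_exp a b t ha hb ht.le).2, mul_comm]
  gcongr
  exact pow_bd a t b ha ht hb

lemma gd_exp_inv_le (a b : ℝ) (ha : 1 < a) (hb : 0 < b) : ∃ c > (0:ℝ), ∀ t > 0,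
    ∫ x in Ioi (0:ℝ), Real.exp (-x * t) / x * gammaDensity a b x ≤ c * t ^ (-(a - 1)) := by
  have hg := Real.Gamma_pos_of_pos (show 0 < a by linarith)
  have hg' := Real.Gamma_pos_of_pos (show 0 < a - 1 by linarith)
  refine ⟨Real.Gamma (a - 1) * (Real.Gamma a * b ^ a)⁻¹, by positivity, fun t ht => ?_⟩
  rw [(gd_exp_inv a b t ha hb ht.le).2, mul_comm]
  gcongr
  exact pow_bd (a - 1) t b (by linarith) ht hb

lemma triple_le (f : ℝ → ℝ → ℝ → ℝ) (p p' q w w' : ℝ → ℝ)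
    (hf : ∀ P R r, 0 < P → 0 < R → 0 < r → 0 ≤ f P R r)
    (hle : ∀ P R r, 0 < P → 0 < R → 0 < r → f P R r ≤ (p P * w r + p' P * w' r) * q R)
    (hp : IntegrableOn p (Ioi 0)) (hp' : IntegrableOn p' (Ioi 0))
    (hq : IntegrableOn q (Ioi 0))
    (hw : IntegrableOn w (Ioi 0)) (hw' : IntegrableOn w' (Ioi 0)) :
    ∫ P in Ioi (0:ℝ), ∫ R in Ioi (0:ℝ), ∫ r in Ioi (0:ℝ), f P R r ≤
      ((∫ P in Ioi (0:ℝ), p P) * (∫ r in Ioi (0:ℝ), w r) +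
       (∫ P in Ioi (0:ℝ), p' P) * (∫ r in Ioi (0:ℝ), w' r)) * ∫ R in Ioi (0:ℝ), q R := by
  have s1 : ∀ P R, 0 < P → 0 < R → ∫ r in Ioi (0:ℝ), f P R r ≤
      (p P * (∫ r in Ioi (0:ℝ), w r) + p' P * (∫ r in Ioi (0:ℝ), w' r)) * q R := by
    intro P R hP hR
    rw [← integral_const_mul, ← integral_const_mul,
      ← integral_add (hw.const_mul _) (hw'.const_mul _), ← integral_mul_const]
    apply integral_mono_of_nonneg
    · exact (ae_restrict_iff' measurableSet_Ioi).2 (ae_of_all _ fun r hr => hf P R r hP hR hr)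
    · exact ((hw.const_mul _).add (hw'.const_mul _)).mul_const _
    · exact (ae_restrict_iff' measurableSet_Ioi).2 (ae_of_all _ fun r hr => hle P R r hP hR hr)
  have n1 : ∀ P R, 0 < P → 0 < R → 0 ≤ ∫ r in Ioi (0:ℝ), f P R r := fun P R hP hR =>
    setIntegral_nonneg measurableSet_Ioi fun r hr => hf P R r hP hR hr
  have s2 : ∀ P, 0 < P → ∫ R in Ioi (0:ℝ), ∫ r in Ioi (0:ℝ), f P R r ≤
      (p P * (∫ r in Ioi (0:ℝ), w r) + p' P * (∫ r in Ioi (0:ℝ), w' r)) *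
        ∫ R in Ioi (0:ℝ), q R := by
    intro P hP
    rw [← integral_const_mul (μ := volume.restrict (Ioi (0:ℝ)))
      (p P * (∫ r in Ioi (0:ℝ), w r) + p' P * (∫ r in Ioi (0:ℝ), w' r))]
    apply integral_mono_of_nonneg
    · exact (ae_restrict_iff' measurableSet_Ioi).2 (ae_of_all _ fun R hR => n1 P R hP hR)
    · exact hq.const_mul _
    · exact (ae_restrict_iff' measurableSet_Ioi).2 (ae_of_all _ fun R hR => s1 P R hP hR)
  rw [← integral_mul_const, ← integral_mul_const,
      ← integral_add (hp.mul_const _) (hp'.mul_const _), ← integral_mul_const]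
  apply integral_mono_of_nonneg
  · exact (ae_restrict_iff' measurableSet_Ioi).2 (ae_of_all _ fun P hP =>
      setIntegral_nonneg measurableSet_Ioi fun R hR => n1 P R hP hR)
  · exact ((hp.mul_const _).add (hp'.mul_const _)).mul_const _
  · exact (ae_restrict_iff' measurableSet_Ioi).2 (ae_of_all _ fun P hP => s2 P hP)

/-- difference quotient bounds -/
lemma quot_bd (P r t : ℝ) (hP : 0 < P) (hr : 0 < r) (ht : 0 ≤ t) (hne : P ≠ r) :
    0 ≤ (Real.exp (-r * t) - Real.exp (-P * t)) / (P - r) ∧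
    (Real.exp (-r * t) - Real.exp (-P * t)) / (P - r) ≤ t ∧
    (Real.exp (-r * t) - Real.exp (-P * t)) / (P - r) ≤ 1 / r := by
  rcases lt_or_gt_of_ne hne with h | h
  · have hd : 0 < r - P := by linarith
    have e : (Real.exp (-r * t) - Real.exp (-P * t)) / (P - r) =
      (Real.exp (-P * t) - Real.exp (-r * t)) / (r - P) := by
      rw [← neg_sub r P, div_neg, ← neg_div, neg_sub]
    rw [e]
    have m : Real.exp (-r * t) ≤ Real.exp (-P * t) := Real.exp_le_exp.2 (by nlinarith)
    have b1 : Real.exp (-P * t) ≤ 1 := Real.exp_le_one_iff.2 (by nlinarith)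
    have b0 := Real.exp_pos (-P * t)
    have b2 := Real.exp_pos (-r * t)
    have x1 : Real.exp (-r * t) = Real.exp (-P * t) * Real.exp (-(r - P) * t) := by
      rw [← Real.exp_add]; ring_nf
    have x2 := Real.add_one_le_exp (-(r - P) * t)
    refine ⟨div_nonneg (by linarith) hd.le, ?_, ?_⟩
    · rw [div_le_iff₀ hd, x1]
      have : 0 ≤ (r - P) * t := by positivity
      nlinarith
    · rw [div_le_div_iff₀ hd hr]
      have cv := convexOn_exp.2 (mem_univ (-r * t)) (mem_univ 0)
        (show 0 ≤ P / r by positivity) (show 0 ≤ 1 - P / r by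
          rw [sub_nonneg, div_le_one hr]; exact h.le) (by ring)
      simp only [smul_eq_mul, mul_zero, add_zero, Real.exp_zero, mul_one] at cv
      rw [show P / r * (-r * t) = -P * t by field_simp] at cv
      have : r * Real.exp (-P * t) ≤ P * Real.exp (-r * t) + (r - P) := by
        calc r * Real.exp (-P * t) ≤ r * (P / r * Real.exp (-r * t) + (1 - P / r)) := by gcongr
          _ = _ := by field_simp
      nlinarith
  · have hd : 0 < P - r := by linarith
    have m : Real.exp (-P * t) ≤ Real.exp (-r * t) := Real.exp_le_exp.2 (by nlinarith)
    have b1 : Real.exp (-r * t) ≤ 1 := Real.exp_le_one_iff.2 (by nlinarith)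
    have b2 := Real.exp_pos (-r * t)
    have x1 : Real.exp (-P * t) = Real.exp (-r * t) * Real.exp (-(P - r) * t) := by
      rw [← Real.exp_add]; ring_nf
    have x2 := Real.add_one_le_exp (-(P - r) * t)
    have x3 : Real.exp (-r * t) - Real.exp (-P * t) ≤ Real.exp (-r * t) * ((P - r) * t) := by
      rw [x1]; nlinarith
    refine ⟨div_nonneg (by linarith) hd.le, ?_, ?_⟩
    · rw [div_le_iff₀ hd]
      have : 0 ≤ (P - r) * t := by positivity
      nlinarith
    · rw [div_le_div_iff₀ hd hr]
      have x4 := Real.add_one_le_exp (r * t)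
      have x5 : Real.exp (-r * t) * Real.exp (r * t) = 1 := by
        rw [← Real.exp_add]; simp
      have x6 : Real.exp (-r * t) * (r * t) ≤ 1 := by nlinarith
      calc _ ≤ (Real.exp (-r * t) * ((P - r) * t)) * r := by gcongr
        _ = (P - r) * (Real.exp (-r * t) * (r * t)) := by ring
        _ ≤ (P - r) * 1 := by gcongr
        _ = _ := by ring

lemma K_bd (P r h : ℝ) (hP : 0 < P) (hr : 0 < r) (hh : 0 ≤ h) (hne : P ≠ r) :
    0 ≤ (Real.exp (-r * h) - Real.exp (-P * h)) / (P - r) ∧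
    (Real.exp (-r * h) - Real.exp (-P * h)) / (P - r) ≤
      Real.exp (-P * (h / 2)) / r + h / 2 * Real.exp (-r * (h / 2)) := by
  refine ⟨(quot_bd P r h hP hr hh hne).1, ?_⟩
  obtain ⟨h0, h1, h2⟩ := quot_bd P r (h / 2) hP hr (by positivity) hne
  have e1 : Real.exp (-r * h) = Real.exp (-r * (h / 2)) * Real.exp (-r * (h / 2)) := by
    rw [← Real.exp_add]; ring_nf
  have e2 : Real.exp (-P * h) = Real.exp (-P * (h / 2)) * Real.exp (-P * (h / 2)) := by
    rw [← Real.exp_add]; ring_nf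
  have b0 := Real.exp_pos (-P * (h / 2))
  have b2 := Real.exp_pos (-r * (h / 2))
  set a := Real.exp (-r * (h / 2))
  set b := Real.exp (-P * (h / 2))
  rw [e1, e2]
  calc (a * a - b * b) / (P - r) = (a - b) / (P - r) * b + (a - b) / (P - r) * a := by ring
    _ ≤ 1 / r * b + h / 2 * a := by gcongr
    _ = _ := by ring

lemma PK_bd (P r h : ℝ) (hP : 0 < P) (hr : 0 < r) (hh : 0 ≤ h) (hne : P ≠ r) :
    P / r * ((Real.exp (-r * h) - Real.exp (-P * h)) / (P - r)) ≤
      Real.exp (-P * (h / 2)) / r + (h / 2 * Real.exp (-r * (h / 2)) +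
        Real.exp (-r * (h / 2)) / r) := by
  obtain ⟨k0, k1⟩ := K_bd P r h hP hr hh hne
  have hd : P - r ≠ 0 := sub_ne_zero.2 hne
  have key : P / r * ((Real.exp (-r * h) - Real.exp (-P * h)) / (P - r)) =
      (Real.exp (-r * h) - Real.exp (-P * h)) / (P - r) +
      (Real.exp (-r * h) - Real.exp (-P * h)) / r := by
    field_simp; ring
  have : (Real.exp (-r * h) - Real.exp (-P * h)) / r ≤ Real.exp (-r * (h / 2)) / r := by
    have e : Real.exp (-r * h) ≤ Real.exp (-r * (h / 2)) := Real.exp_le_exp.2 (by nlinarith)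
    have := Real.exp_pos (-P * h)
    gcongr
    linarith
  rw [key]; linarith

lemma I2_le (ar br aR bR : ℝ) (har1 : 1 < ar) (hbr : 0 < br) (haR : 0 < aR) (hbR : 0 < bR) :
    ∃ c > (0:ℝ), ∀ h > 0, I2 ar br aR bR h ≤ c * h ^ (-aR) := by
  obtain ⟨c, hc, hcb⟩ := gd_exp_le aR bR haR hbR
  obtain ⟨iq, vq⟩ := gd_exp aR bR 0 haR hbR le_rfl
  obtain ⟨iw, vw⟩ := gd_exp_inv ar br 0 har1 hbr le_rfl
  have hg := Real.Gamma_pos_of_pos (show 0 < ar by linarith)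
  have hg' := Real.Gamma_pos_of_pos (show 0 < ar - 1 by linarith)
  have hgR := Real.Gamma_pos_of_pos haR
  set Q := ∫ x in Ioi (0:ℝ), Real.exp (-x * 0) * gammaDensity aR bR x with hQ
  set W := ∫ x in Ioi (0:ℝ), Real.exp (-x * 0) / x * gammaDensity ar br x with hW
  have Qp : 0 < Q := by rw [vq]; positivity
  have Wp : 0 < W := by rw [vw]; positivity
  refine ⟨c * (2 * W) * Q, by positivity, fun h hh => ?_⟩
  have ip := (gd_exp aR bR h haR hbR hh.le).1
  unfold I2
  refine (triple_le _ (fun x => Real.exp (-x * h) * gammaDensity aR bR x) (fun _ => 0)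
    (fun x => Real.exp (-x * 0) * gammaDensity aR bR x)
    (fun x => 2 * (Real.exp (-x * 0) / x * gammaDensity ar br x)) (fun _ => 0)
    ?_ ?_ ip integrableOn_zero iq (iw.const_mul 2) integrableOn_zero).trans ?_
  · intro P R r hP hR hr
    have := gd_pos ar br r (by linarith) hbr hr
    have := gd_pos aR bR R haR hbR hR
    have := gd_pos aR bR P haR hbR hP
    positivity
  · intro P R r hP hR hr
    have g1 := gd_pos ar br r (by linarith) hbr hr
    have g2 := gd_pos aR bR R haR hbR hR
    have g3 := gd_pos aR bR P haR hbR hP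
    have b : (R * P / (r * (P + R))) * (1 / (P + r) + 1 / (R + r)) ≤ 2 / r := by
      have e : (R * P / (r * (P + R))) * (1 / (P + r) + 1 / (R + r)) =
        (R / (P + R) * (P / (P + r)) + P / (P + R) * (R / (R + r))) / r := by
        field_simp
      have a1 : R / (P + R) ≤ 1 := (div_le_one (by positivity)).2 (by linarith)
      have a2 : P / (P + r) ≤ 1 := (div_le_one (by positivity)).2 (by linarith)
      have a3 : P / (P + R) ≤ 1 := (div_le_one (by positivity)).2 (by linarith)
      have a4 : R / (R + r) ≤ 1 := (div_le_one (by positivity)).2 (by linarith)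
      rw [e]
      gcongr
      have := mul_le_one₀ a1 (by positivity) a2
      have := mul_le_one₀ a3 (by positivity) a4
      linarith
    calc _ ≤ 2 / r * Real.exp (-P * h) *
      gammaDensity ar br r * gammaDensity aR bR R * gammaDensity aR bR P := by gcongr
      _ = _ := by simp; ring
  · rw [integral_const_mul]
    simp only [integral_zero, mul_zero, add_zero]
    have := hcb h hh
    simp only [mul_zero] at hQ hW
    rw [← hQ, ← hW]
    calc _ ≤ (c * h ^ (-aR)) * (2 * W) * Q := by gcongr
      _ = _ := by ring

lemma I3_le (ar br aR bR : ℝ) (har1 : 1 < ar) (hbr : 0 < br) (haR : 0 < aR) (hbR : 0 < bR) :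
    ∃ c > (0:ℝ), ∃ c' > (0:ℝ), ∀ h > 0, I3 ar br aR bR h ≤
      c * (h / 2) ^ (-aR) + c' * (h / 2) ^ (-(ar - 1)) := by
  obtain ⟨c, hc, hcb⟩ := gd_exp_le aR bR haR hbR
  obtain ⟨d, hd, hdb⟩ := gd_exp_le ar br (by linarith) hbr
  obtain ⟨d', hd', hdb'⟩ := gd_exp_inv_le ar br har1 hbr
  obtain ⟨iq, vq⟩ := gd_exp aR bR 0 haR hbR le_rfl
  obtain ⟨iw, vw⟩ := gd_exp_inv ar br 0 har1 hbr le_rfl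
  have hg := Real.Gamma_pos_of_pos (show 0 < ar by linarith)
  have hg' := Real.Gamma_pos_of_pos (show 0 < ar - 1 by linarith)
  have hgR := Real.Gamma_pos_of_pos haR
  set Q := ∫ x in Ioi (0:ℝ), Real.exp (-x * 0) * gammaDensity aR bR x with hQ
  set W := ∫ x in Ioi (0:ℝ), Real.exp (-x * 0) / x * gammaDensity ar br x with hW
  have Qp : 0 < Q := by rw [vq]; positivity
  have Wp : 0 < W := by rw [vw]; positivity
  refine ⟨c * W * Q, by positivity, Q * (d + d') * Q, by positivity, fun h hh => ?_⟩
  have hh2 : 0 < h / 2 := by positivity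
  have ip := (gd_exp aR bR (h / 2) haR hbR hh2.le).1
  have iw1 := (gd_exp ar br (h / 2) (by linarith) hbr hh2.le).1
  have iw2 := (gd_exp_inv ar br (h / 2) har1 hbr hh2.le).1
  have drop : I3 ar br aR bR h = ∫ P in Ioi (0:ℝ), ∫ R in Ioi (0:ℝ), ∫ r in Ioi (0:ℝ),
    (if P = r then 0
      else (R * P / (r * (R + r) * (P - r))) *
        (Real.exp (-r * h) - Real.exp (-P * h))) *
      gammaDensity ar br r * gammaDensity aR bR R * gammaDensity aR bR P := by
    unfold I3
    congr 1; funext P; congr 1; funext R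
    apply integral_congr_ae
    have : ∀ᵐ r ∂(volume.restrict (Ioi (0:ℝ))), r ≠ P := by
      apply ae_restrict_of_ae
      simp [ae_iff]
    filter_upwards [this] with r hr
    rw [if_neg (Ne.symm hr), if_neg (Ne.symm hr)]
  rw [drop]
  refine (triple_le _ (fun x => Real.exp (-x * (h / 2)) * gammaDensity aR bR x)
    (fun x => Real.exp (-x * 0) * gammaDensity aR bR x)
    (fun x => Real.exp (-x * 0) * gammaDensity aR bR x)
    (fun x => Real.exp (-x * 0) / x * gammaDensity ar br x)
    (fun x => h / 2 * (Real.exp (-x * (h / 2)) * gammaDensity ar br x) +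
      Real.exp (-x * (h / 2)) / x * gammaDensity ar br x)
    ?_ ?_ ip iq iq iw ((iw1.const_mul (h / 2)).add iw2)).trans ?_
  · intro P R r hP hR hr
    have := gd_pos ar br r (by linarith) hbr hr
    have := gd_pos aR bR R haR hbR hR
    have := gd_pos aR bR P haR hbR hP
    split_ifs with hPr
    · simp
    · have k0 := (K_bd P r h hP hr hh.le hPr).1
      have e : (R * P / (r * (R + r) * (P - r))) * (Real.exp (-r * h) - Real.exp (-P * h)) =
        (R * P / (r * (R + r))) * ((Real.exp (-r * h) - Real.exp (-P * h)) / (P - r)) := by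
        rw [← div_div]; ring
      rw [e]
      positivity
  · intro P R r hP hR hr
    have g1 := gd_pos ar br r (by linarith) hbr hr
    have g2 := gd_pos aR bR R haR hbR hR
    have g3 := gd_pos aR bR P haR hbR hP
    split_ifs with hPr
    · simp only [zero_mul]
      positivity
    · have k0 := (K_bd P r h hP hr hh.le hPr).1
      have k1 := PK_bd P r h hP hr hh.le hPr
      have e : (R * P / (r * (R + r) * (P - r))) * (Real.exp (-r * h) - Real.exp (-P * h)) =
        (R / (R + r)) * (P / r * ((Real.exp (-r * h) - Real.exp (-P * h)) / (P - r))) := by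
        have : P - r ≠ 0 := sub_ne_zero.2 hPr
        field_simp
      have a4 : R / (R + r) ≤ 1 := (div_le_one (by positivity)).2 (by linarith)
      rw [e]
      calc _ ≤ 1 * (Real.exp (-P * (h / 2)) / r + (h / 2 * Real.exp (-r * (h / 2)) +
        Real.exp (-r * (h / 2)) / r)) *
        gammaDensity ar br r * gammaDensity aR bR R * gammaDensity aR bR P := by gcongr
        _ = _ := by simp; ring
  · rw [integral_add (iw1.const_mul (h / 2)) iw2, integral_const_mul, ← hQ, ← hW]
    have b1 := hcb _ hh2
    have b2 := hdb _ hh2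
    have b3 := hdb' _ hh2
    have e : h / 2 * (h / 2) ^ (-ar) = (h / 2) ^ (-(ar - 1)) := by
      rw [show -(ar - 1) = -ar + 1 by ring, Real.rpow_add_one hh2.ne']; ring
    calc _ ≤ ((c * (h / 2) ^ (-aR)) * W + Q * (h / 2 * (d * (h / 2) ^ (-ar)) +
            d' * (h / 2) ^ (-(ar - 1)))) * Q := by gcongr
      _ = ((c * (h / 2) ^ (-aR)) * W + Q * (d * (h / 2 * (h / 2) ^ (-ar)) +
            d' * (h / 2) ^ (-(ar - 1)))) * Q := by ring
      _ = _ := by rw [e]; ring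

theorem stmt8 (ar br aR bR A B : ℝ) (har1 : 1 < ar) (har2 : ar ≤ 2)
    (hbr : 0 < br) (haR : 0 < aR) (hbR : 0 < bR)
    (hcond : (ar - 1) * (aR + 2) > 1) (hA : 0 < A) (hB : 0 ≤ B) :
    ∃ C > (0:ℝ), ∃ h₀ > (0:ℝ), ∀ h ≥ h₀,
      ACX ar br aR bR A B h ≤
        C * (A * h ^ (-aR) +
          B * (h ^ (-aR) + h ^ (-(((ar - 1) * (aR + 2) - 1) / (aR + 2))))) := by
  obtain ⟨c1, hc1, b1⟩ := gd_exp_le aR bR haR hbR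
  obtain ⟨c2, hc2, b2⟩ := I2_le ar br aR bR har1 hbr haR hbR
  obtain ⟨c3, hc3, c4, hc4, b3⟩ := I3_le ar br aR bR har1 hbr haR hbR
  have hgR := Real.Gamma_pos_of_pos haR
  have p1 : 0 < I1 aR bR 0 := by
    unfold I1
    rw [(gd_exp aR bR 0 haR hbR le_rfl).2]
    positivity
  have p2 : 0 ≤ I2 ar br aR bR 0 := by
    unfold I2
    refine setIntegral_nonneg measurableSet_Ioi fun P hP => setIntegral_nonneg measurableSet_Ioi
      fun R hR => setIntegral_nonneg measurableSet_Ioi fun r hr => ?_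
    have hP : 0 < P := hP
    have hR : 0 < R := hR
    have hr : 0 < r := hr
    have := gd_pos ar br r (by linarith) hbr hr
    have := gd_pos aR bR R haR hbR hR
    have := gd_pos aR bR P haR hbR hP
    positivity
  have p3 : I3 ar br aR bR 0 = 0 := by
    unfold I3; simp
  set D := A * I1 aR bR 0 + B * (I2 ar br aR bR 0 + I3 ar br aR bR 0) with hD
  have Dp : 0 < D := by rw [hD, p3]; positivity
  set M := c1 + c2 + c3 * (1 / 2) ^ (-aR) + c4 * (1 / 2) ^ (-(ar - 1)) with hM
  refine ⟨M / D, by positivity, 1, one_pos, fun h hh => ?_⟩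
  have hp : 0 < h := by linarith
  unfold ACX
  rw [← hD, div_mul_eq_mul_div]
  gcongr
  have q1 : I1 aR bR h ≤ c1 * h ^ (-aR) := b1 h hp
  have q2 := b2 h hp
  have q3 := b3 h hp
  rw [div_eq_mul_one_div, Real.mul_rpow hp.le (by norm_num),
    Real.mul_rpow hp.le (by norm_num)] at q3
  have q4 : h ^ (-(ar - 1)) ≤ h ^ (-(((ar - 1) * (aR + 2) - 1) / (aR + 2))) := by
    apply Real.rpow_le_rpow_of_exponent_le hh
    rw [neg_le_neg_iff, div_le_iff₀ (by linarith)]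
    linarith
  set X := h ^ (-aR)
  set Y := h ^ (-(((ar - 1) * (aR + 2) - 1) / (aR + 2)))
  have X0 : 0 ≤ X := by positivity
  have Y0 : 0 ≤ Y := by positivity
  set u : ℝ := (1 / 2) ^ (-aR)
  set v : ℝ := (1 / 2) ^ (-(ar - 1))
  have u0 : 0 ≤ u := by positivity
  have v0 : 0 ≤ v := by positivity
  have q5 : c4 * (h ^ (-(ar - 1)) * v) ≤ c4 * v * Y := by
    calc _ ≤ c4 * (Y * v) := by gcongr
      _ = _ := by ring
  have r1 : I1 aR bR h ≤ M * X := by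
    refine q1.trans ?_
    gcongr
    have : 0 ≤ c3 * u := by positivity
    have : 0 ≤ c4 * v := by positivity
    linarith
  have r2 : I2 ar br aR bR h + I3 ar br aR bR h ≤ M * (X + Y) := by
    have t1 : 0 ≤ c1 * X := by positivity
    have t2 : 0 ≤ c4 * v * X := by positivity
    have t3 : 0 ≤ (c1 + c2 + c3 * u) * Y := by positivity
    rw [hM]; nlinarith
  calc _ ≤ A * (M * X) + B * (M * (X + Y)) := by gcongr
    _ = _ := by ring
end
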